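/- Let λ, μ ∈ (0,∞), t > 0 and let u, h be graphons. For k ∈ ℕ define G_k := inf_{σ∈M} sup over measurable partitions {A₁,…,A_k} of [0,1] of Σ_{i,j=1}^{k} Leb(A_i)·Leb(A_j)·I_{1,t}( ū(A_i×A_j), \overline{h^σ}(A_i×A_j) ), where ū(A×B) is the average of u over A×B (terms with Leb(A_i)·Leb(A_j) = 0 contribute 0). Then lim_{k→∞} G_k = inf_{σ∈M} I_{1,t}(u, h^σ). -/

import Mathlib

noncomputable section

open MeasureTheory Real Filter

/-- Probability that an initially inactive edge is active at time `t`. -/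
def p01 (lam mu t : ℝ) : ℝ := (lam - lam * Real.exp (-(t * (lam + mu)))) / (lam + mu)

/-- Probability that an initially active edge is active at time `t`. -/
def p11 (lam mu t : ℝ) : ℝ := (lam + mu * Real.exp (-(t * (lam + mu)))) / (lam + mu)

/-- The cumulant-type function `J_{t,v}(u)`. -/
def Jfun (lam mu t v u : ℝ) : ℝ :=
  u * Real.log (1 - p11 lam mu t + Real.exp v * p11 lam mu t) +
  (1 - u) * Real.log (1 - p01 lam mu t + Real.exp v * p01 lam mu t)

/-- The one-step rate function `I_{1,t}(u,x) = sup_v [v x - J_{t,v}(u)]`. -/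
def I1 (lam mu t u x : ℝ) : ℝ := ⨆ v : ℝ, (v * x - Jfun lam mu t v u)

/-- A graphon: a measurable symmetric function with values in `[0,1]`. -/
def IsGraphon (f : ℝ → ℝ → ℝ) : Prop :=
  Measurable (Function.uncurry f) ∧ (∀ x y, f x y ∈ Set.Icc (0:ℝ) 1) ∧ ∀ x y, f x y = f y x

/-- The unit square `[0,1]²`. -/
def unitSq : Set (ℝ × ℝ) := Set.Icc (0:ℝ) 1 ×ˢ Set.Icc (0:ℝ) 1

/-- The cut distance between two (bounded measurable) kernels on `[0,1]²`. -/
def cutDist (f g : ℝ → ℝ → ℝ) : ℝ :=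
  ⨆ S : {S : Set ℝ // MeasurableSet S ∧ S ⊆ Set.Icc (0:ℝ) 1},
    ⨆ T : {T : Set ℝ // MeasurableSet T ∧ T ⊆ Set.Icc (0:ℝ) 1},
      |∫ p in S.1 ×ˢ T.1, (f p.1 p.2 - g p.1 p.2)|

/-- A measure-preserving bijection of `[0,1]` (measure preserving in both directions). -/
def IsMPB (σ : ℝ → ℝ) : Prop :=
  Measurable σ ∧ Set.BijOn σ (Set.Icc (0:ℝ) 1) (Set.Icc (0:ℝ) 1) ∧
  ∀ A : Set ℝ, MeasurableSet A → A ⊆ Set.Icc (0:ℝ) 1 →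
    volume (σ ⁻¹' A ∩ Set.Icc (0:ℝ) 1) = volume A ∧ volume (σ '' A) = volume A

/-- The relabelling `h^σ` of a kernel by a map `σ`. -/
def perm (σ : ℝ → ℝ) (h : ℝ → ℝ → ℝ) : ℝ → ℝ → ℝ := fun x y => h (σ x) (σ y)

/-- The cut metric `δ_□`. -/
def cutMetric (f g : ℝ → ℝ → ℝ) : ℝ :=
  ⨅ σ₁ : {σ : ℝ → ℝ // IsMPB σ}, ⨅ σ₂ : {σ : ℝ → ℝ // IsMPB σ},
    cutDist (perm σ₁.1 f) (perm σ₂.1 g)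

/-- The rate functional `I_{1,t}(u,h)` for kernels `u, h`. -/
def I1W (lam mu t : ℝ) (u h : ℝ → ℝ → ℝ) : ℝ :=
  ∫ p in unitSq, I1 lam mu t (u p.1 p.2) (h p.1 p.2)

/-- The rate functional `Ĩ_{1,t}(u,h) = inf_σ I_{1,t}(u, h^σ)`. -/
def I1tilde (lam mu t : ℝ) (u h : ℝ → ℝ → ℝ) : ℝ :=
  ⨅ σ : {σ : ℝ → ℝ // IsMPB σ}, I1W lam mu t u (perm σ.1 h)

/-- The average of a kernel over a rectangle `A × B` (junk value when the rectangle is null). -/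
def avgOn (f : ℝ → ℝ → ℝ) (A B : Set ℝ) : ℝ :=
  (∫ p in A ×ˢ B, f p.1 p.2) / ((volume A).toReal * (volume B).toReal)

/-- Measurable `k`-set partitions of `[0,1]`. -/
def IsPartition (k : ℕ) (A : Fin k → Set ℝ) : Prop :=
  (∀ i, MeasurableSet (A i)) ∧ (∀ i j, i ≠ j → Disjoint (A i) (A j)) ∧
    (⋃ i, A i) = Set.Icc (0:ℝ) 1

def ell (p v : ℝ) : ℝ := Real.log (1 - p + Real.exp v * p)

lemma ell_arg_pos {p : ℝ} (h0 : 0 < p) (h1 : p < 1) (v : ℝ) : 0 < 1 - p + Real.exp v * p := by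
  have := mul_pos (Real.exp_pos v) h0
  linarith

lemma ell_abs {p : ℝ} (h0 : 0 < p) (h1 : p < 1) (v : ℝ) : |ell p v| ≤ |v| := by
  have hpos := ell_arg_pos h0 h1 v
  unfold ell
  rcases le_total 0 v with hv | hv
  · have he : 1 ≤ Real.exp v := Real.one_le_exp hv
    have h2 : 0 ≤ Real.log (1 - p + Real.exp v * p) := Real.log_nonneg (by nlinarith)
    rw [abs_of_nonneg h2, abs_of_nonneg hv, Real.log_le_iff_le_exp hpos]
    nlinarith
  · have he : Real.exp v ≤ 1 := Real.exp_le_one_iff.2 hv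
    have h2 : Real.log (1 - p + Real.exp v * p) ≤ 0 := Real.log_nonpos hpos.le (by nlinarith)
    rw [abs_of_nonpos h2, abs_of_nonpos hv, neg_le_neg_iff, Real.le_log_iff_exp_le hpos]
    nlinarith

lemma ell_tail_pos {p : ℝ} (h0 : 0 < p) (h1 : p < 1) (V v : ℝ) :
    ell p V - ell p v ≤ V - v + (1 - p) / p * Real.exp (-V) := by
  have hV := ell_arg_pos h0 h1 V
  have hv := ell_arg_pos h0 h1 v
  have e1 : ell p v ≥ v + Real.log p := by
    have : Real.log (Real.exp v * p) = v + Real.log p := by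
      rw [Real.log_mul (Real.exp_pos v).ne' h0.ne', Real.log_exp]
    unfold ell
    rw [← this]
    exact Real.log_le_log (mul_pos (Real.exp_pos v) h0) (by linarith)
  have e2 : ell p V ≤ V + Real.log p + (1 - p) / p * Real.exp (-V) := by
    have hq : 0 < 1 + (1 - p) / p * Real.exp (-V) := by
      have : 0 ≤ (1 - p) / p := div_nonneg (by linarith) h0.le
      positivity
    have : 1 - p + Real.exp V * p = Real.exp V * p * (1 + (1 - p) / p * Real.exp (-V)) := by
      rw [Real.exp_neg]
      have := (Real.exp_pos V).ne'
      field_simp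
      ring
    unfold ell
    rw [this, Real.log_mul (mul_pos (Real.exp_pos V) h0).ne' hq.ne',
      Real.log_mul (Real.exp_pos V).ne' h0.ne', Real.log_exp]
    have := Real.log_le_sub_one_of_pos hq
    linarith
  linarith

lemma ell_tail_neg {p : ℝ} (h0 : 0 < p) (h1 : p < 1) (V v : ℝ) :
    ell p (-V) - ell p v ≤ p / (1 - p) * Real.exp (-V) := by
  have h1' : 0 < 1 - p := by linarith
  have e1 : ell p v ≥ Real.log (1 - p) := by
    unfold ell
    exact Real.log_le_log h1' (by have := mul_pos (Real.exp_pos v) h0; linarith)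
  have e2 : ell p (-V) ≤ Real.log (1 - p) + p / (1 - p) * Real.exp (-V) := by
    have hq : 0 < 1 + p / (1 - p) * Real.exp (-V) := by positivity
    have : 1 - p + Real.exp (-V) * p = (1 - p) * (1 + p / (1 - p) * Real.exp (-V)) := by
      field_simp
    unfold ell
    rw [this, Real.log_mul h1'.ne' hq.ne']
    have := Real.log_le_sub_one_of_pos hq
    linarith
  linarith

/-- The function inside the supremum. -/
def gg (p q u x v : ℝ) : ℝ := v * x - (u * ell p v + (1 - u) * ell q v)

/-- The constant in the tail estimate. -/
def CC (p q : ℝ) : ℝ := (1 - p) / p + (1 - q) / q + p / (1 - p) + q / (1 - q)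

lemma convex_le {u a b c d : ℝ} (hu : u ∈ Set.Icc (0:ℝ) 1) (ha : a ≤ c + d) (hb : b ≤ c + d) :
    u * a + (1 - u) * b ≤ c + d := by
  have h1 := mul_le_mul_of_nonneg_left ha hu.1
  have h2 := mul_le_mul_of_nonneg_left hb (sub_nonneg.2 hu.2)
  linarith

lemma gg_tail {p q : ℝ} (hp : p ∈ Set.Ioo (0:ℝ) 1) (hq : q ∈ Set.Ioo (0:ℝ) 1) {u x : ℝ}
    (hu : u ∈ Set.Icc (0:ℝ) 1) (hx : x ∈ Set.Icc (0:ℝ) 1) {V : ℝ} (hV : 0 ≤ V) (v : ℝ) :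
    ∃ w, |w| ≤ V ∧ gg p q u x v ≤ gg p q u x w + CC p q * Real.exp (-V) := by
  have hE := Real.exp_pos (-V)
  have a1 : 0 < (1 - p) / p := div_pos (by linarith [hp.2]) hp.1
  have a2 : 0 < (1 - q) / q := div_pos (by linarith [hq.2]) hq.1
  have a3 : 0 < p / (1 - p) := div_pos hp.1 (by linarith [hp.2])
  have a4 : 0 < q / (1 - q) := div_pos hq.1 (by linarith [hq.2])
  have m1 := mul_pos a1 hE
  have m2 := mul_pos a2 hE
  have m3 := mul_pos a3 hE
  have m4 := mul_pos a4 hE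
  have hC : CC p q * Real.exp (-V) = (1 - p) / p * Real.exp (-V) + (1 - q) / q * Real.exp (-V)
    + p / (1 - p) * Real.exp (-V) + q / (1 - q) * Real.exp (-V) := by unfold CC; ring
  rcases lt_or_ge V v with h | h
  · refine ⟨V, by rw [abs_of_nonneg hV], ?_⟩
    have b1 := ell_tail_pos hp.1 hp.2 V v
    have b2 := ell_tail_pos hq.1 hq.2 V v
    have := convex_le (c := V - v) (d := CC p q * Real.exp (-V)) hu
      (a := ell p V - ell p v) (b := ell q V - ell q v) (by linarith) (by linarith)
    have h3 : 0 ≤ (v - V) * (1 - x) := mul_nonneg (by linarith) (by linarith [hx.2])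
    unfold gg
    nlinarith
  · rcases lt_or_ge v (-V) with h' | h'
    · refine ⟨-V, by rw [abs_neg, abs_of_nonneg hV], ?_⟩
      have b1 := ell_tail_neg hp.1 hp.2 V v
      have b2 := ell_tail_neg hq.1 hq.2 V v
      have := convex_le (c := 0) (d := CC p q * Real.exp (-V)) hu
        (a := ell p (-V) - ell p v) (b := ell q (-V) - ell q v) (by linarith) (by linarith)
      have h3 : 0 ≤ (-V - v) * x := mul_nonneg (by linarith) hx.1
      unfold gg
      nlinarith
    · refine ⟨v, abs_le.2 ⟨h', h⟩, ?_⟩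
      linarith

lemma gg_zero (p q u x : ℝ) : gg p q u x 0 = 0 := by simp [gg, ell]

lemma gg_bdd {p q : ℝ} (hp : p ∈ Set.Ioo (0:ℝ) 1) (hq : q ∈ Set.Ioo (0:ℝ) 1) {u x : ℝ}
    (hu : u ∈ Set.Icc (0:ℝ) 1) (hx : x ∈ Set.Icc (0:ℝ) 1) (v : ℝ) :
    gg p q u x v ≤ CC p q := by
  obtain ⟨w, hw, h⟩ := gg_tail hp hq hu hx le_rfl v
  have : w = 0 := by simpa using hw
  subst this
  simpa [gg_zero] using h

lemma I1_eq (lam mu t u x : ℝ) :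
    I1 lam mu t u x = ⨆ v, gg (p11 lam mu t) (p01 lam mu t) u x v := rfl

lemma p11_mem {lam mu t : ℝ} (hlam : 0 < lam) (hmu : 0 < mu) (ht : 0 < t) :
    p11 lam mu t ∈ Set.Ioo (0:ℝ) 1 := by
  have hE := Real.exp_pos (-(t * (lam + mu)))
  have hE1 : Real.exp (-(t * (lam + mu))) < 1 := by
    rw [Real.exp_lt_one_iff]; have : 0 < t * (lam + mu) := by positivity
    linarith
  unfold p11
  constructor
  · positivity
  · rw [div_lt_one (by positivity)]; nlinarith

lemma p01_mem {lam mu t : ℝ} (hlam : 0 < lam) (hmu : 0 < mu) (ht : 0 < t) :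
    p01 lam mu t ∈ Set.Ioo (0:ℝ) 1 := by
  have hE := Real.exp_pos (-(t * (lam + mu)))
  have hE1 : Real.exp (-(t * (lam + mu))) < 1 := by
    rw [Real.exp_lt_one_iff]; have : 0 < t * (lam + mu) := by positivity
    linarith
  unfold p01
  constructor
  · apply div_pos _ (by positivity); nlinarith
  · rw [div_lt_one (by positivity)]; nlinarith

section
variable {lam mu t : ℝ} (hlam : 0 < lam) (hmu : 0 < mu) (ht : 0 < t)

lemma gg_le_I1 (hlam : 0 < lam) (hmu : 0 < mu) (ht : 0 < t) {u x : ℝ}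
    (hu : u ∈ Set.Icc (0:ℝ) 1) (hx : x ∈ Set.Icc (0:ℝ) 1) (v : ℝ) :
    gg (p11 lam mu t) (p01 lam mu t) u x v ≤ I1 lam mu t u x := by
  rw [I1_eq]
  refine le_ciSup (f := fun v => gg (p11 lam mu t) (p01 lam mu t) u x v)
    ⟨CC (p11 lam mu t) (p01 lam mu t), ?_⟩ v
  rintro _ ⟨v, rfl⟩
  exact gg_bdd (p11_mem hlam hmu ht) (p01_mem hlam hmu ht) hu hx v

lemma I1_nonneg (hlam : 0 < lam) (hmu : 0 < mu) (ht : 0 < t) {u x : ℝ}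
    (hu : u ∈ Set.Icc (0:ℝ) 1) (hx : x ∈ Set.Icc (0:ℝ) 1) : 0 ≤ I1 lam mu t u x := by
  have := gg_le_I1 hlam hmu ht hu hx 0
  rwa [gg_zero] at this

lemma I1_le (hlam : 0 < lam) (hmu : 0 < mu) (ht : 0 < t) {u x : ℝ}
    (hu : u ∈ Set.Icc (0:ℝ) 1) (hx : x ∈ Set.Icc (0:ℝ) 1) :
    I1 lam mu t u x ≤ CC (p11 lam mu t) (p01 lam mu t) := by
  rw [I1_eq]
  exact ciSup_le (gg_bdd (p11_mem hlam hmu ht) (p01_mem hlam hmu ht) hu hx)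

lemma I1_unif (hlam : 0 < lam) (hmu : 0 < mu) (ht : 0 < t) {ε : ℝ} (hε : 0 < ε) :
    ∃ L : ℝ, 0 ≤ L ∧ ∀ u ∈ Set.Icc (0:ℝ) 1, ∀ x ∈ Set.Icc (0:ℝ) 1, ∀ u' ∈ Set.Icc (0:ℝ) 1,
      ∀ x' ∈ Set.Icc (0:ℝ) 1,
      I1 lam mu t u x ≤ I1 lam mu t u' x' + ε + L * (|u - u'| + |x - x'|) := by
  have hp := p11_mem hlam hmu ht
  have hq := p01_mem hlam hmu ht
  have hlim : Tendsto (fun V : ℝ => CC (p11 lam mu t) (p01 lam mu t) * Real.exp (-V)) atTop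
      (nhds 0) := by
    have := (Real.tendsto_exp_neg_atTop_nhds_zero).const_mul (CC (p11 lam mu t) (p01 lam mu t))
    simpa using this
  obtain ⟨V, hV1, hV⟩ := ((hlim.eventually (gt_mem_nhds hε)).and (eventually_ge_atTop 0)).exists
  refine ⟨2 * V, by positivity, fun u hu x hx u' hu' x' hx' => ?_⟩
  rw [I1_eq]
  refine ciSup_le fun v => ?_
  obtain ⟨w, hw, h⟩ := gg_tail hp hq hu hx hV v
  have h2 := gg_le_I1 hlam hmu ht hu' hx' w
  have h3 : gg (p11 lam mu t) (p01 lam mu t) u x w - gg (p11 lam mu t) (p01 lam mu t) u' x' w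
      ≤ 2 * V * (|u - u'| + |x - x'|) := by
    have e : gg (p11 lam mu t) (p01 lam mu t) u x w - gg (p11 lam mu t) (p01 lam mu t) u' x' w
      = w * (x - x') + (u - u') * (ell (p01 lam mu t) w - ell (p11 lam mu t) w) := by
      unfold gg; ring
    rw [e]
    have k1 : w * (x - x') ≤ V * |x - x'| := by
      calc w * (x - x') ≤ |w * (x - x')| := le_abs_self _
        _ = |w| * |x - x'| := abs_mul _ _
        _ ≤ _ := mul_le_mul_of_nonneg_right hw (abs_nonneg _)
    have k2 : |ell (p01 lam mu t) w - ell (p11 lam mu t) w| ≤ 2 * V := by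
      have := abs_sub (ell (p01 lam mu t) w) (ell (p11 lam mu t) w)
      linarith [ell_abs hp.1 hp.2 w, ell_abs hq.1 hq.2 w]
    have k3 : (u - u') * (ell (p01 lam mu t) w - ell (p11 lam mu t) w) ≤ |u - u'| * (2 * V) := by
      calc _ ≤ |(u - u') * (ell (p01 lam mu t) w - ell (p11 lam mu t) w)| := le_abs_self _
        _ = |u - u'| * _ := abs_mul _ _
        _ ≤ _ := mul_le_mul_of_nonneg_left k2 (abs_nonneg _)
    nlinarith [mul_nonneg hV (abs_nonneg (x - x'))]
  linarith

lemma I1_cont (hlam : 0 < lam) (hmu : 0 < mu) (ht : 0 < t) :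
    Continuous (fun z : Set.Icc (0:ℝ) 1 × Set.Icc (0:ℝ) 1 => I1 lam mu t z.1 z.2) := by
  rw [Metric.continuous_iff]
  intro z ε hε
  obtain ⟨L, hL, h⟩ := I1_unif hlam hmu ht (half_pos hε)
  refine ⟨ε / (4 * (L + 1)), by positivity, fun y hy => ?_⟩
  rw [Prod.dist_eq, max_lt_iff, Subtype.dist_eq, Subtype.dist_eq, Real.dist_eq, Real.dist_eq] at hy
  rw [lt_div_iff₀ (by positivity), lt_div_iff₀ (by positivity)] at hy
  have h1 := h y.1 y.1.2 y.2 y.2.2 z.1 z.1.2 z.2 z.2.2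
  have h2 := h z.1 z.1.2 z.2 z.2.2 y.1 y.1.2 y.2 y.2.2
  rw [abs_sub_comm (z.1:ℝ), abs_sub_comm (z.2:ℝ)] at h2
  have n1 := abs_nonneg ((y.1:ℝ) - z.1)
  have n2 := abs_nonneg ((y.2:ℝ) - z.2)
  rw [Real.dist_eq, abs_lt]
  constructor <;> nlinarith

lemma I1_meas (hlam : 0 < lam) (hmu : 0 < mu) (ht : 0 < t) {f g : ℝ × ℝ → ℝ}
    (hf : Measurable f) (hg : Measurable g)
    (hf' : ∀ z, f z ∈ Set.Icc (0:ℝ) 1) (hg' : ∀ z, g z ∈ Set.Icc (0:ℝ) 1) :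
    Measurable (fun z => I1 lam mu t (f z) (g z)) :=
  (I1_cont hlam hmu ht).measurable.comp
    ((hf.subtype_mk (h := hf')).prodMk (hg.subtype_mk (h := hg')))

end

lemma bint {S : Set (ℝ × ℝ)} (hS : volume S ≠ ⊤) {f : ℝ × ℝ → ℝ} (hf : Measurable f) (C : ℝ)
    (hC : ∀ z, |f z| ≤ C) : IntegrableOn f S :=
  Measure.integrableOn_of_bounded hS hf.aestronglyMeasurable (M := C)
    (Eventually.of_forall fun z => by simpa using hC z)

lemma bint01 {S : Set (ℝ × ℝ)} (hS : volume S ≠ ⊤) {f : ℝ × ℝ → ℝ} (hf : Measurable f)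
    (hf' : ∀ z, f z ∈ Set.Icc (0:ℝ) 1) : IntegrableOn f S :=
  bint hS hf 1 fun z => by rw [abs_of_nonneg (hf' z).1]; exact (hf' z).2

lemma avg_mem {S : Set (ℝ × ℝ)} (hS : volume S ≠ ⊤) {f : ℝ × ℝ → ℝ} (hf : Measurable f)
    (hf' : ∀ z, f z ∈ Set.Icc (0:ℝ) 1) :
    (∫ z in S, f z) / volume.real S ∈ Set.Icc (0:ℝ) 1 := by
  constructor
  · exact div_nonneg (integral_nonneg fun z => (hf' z).1) measureReal_nonneg
  · refine div_le_one_of_le₀ ?_ measureReal_nonneg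
    have : ∫ z in S, f z ≤ ∫ z in S, (1:ℝ) :=
      integral_mono (bint01 hS hf hf') (bint hS measurable_const 1 (by simp)) fun z => (hf' z).2
    simpa using this

lemma bintI {lam mu t : ℝ} (hlam : 0 < lam) (hmu : 0 < mu) (ht : 0 < t)
    {S : Set (ℝ × ℝ)} (hS : volume S ≠ ⊤) {f g : ℝ × ℝ → ℝ} (hf : Measurable f) (hg : Measurable g)
    (hf' : ∀ z, f z ∈ Set.Icc (0:ℝ) 1) (hg' : ∀ z, g z ∈ Set.Icc (0:ℝ) 1) :
    IntegrableOn (fun z => I1 lam mu t (f z) (g z)) S :=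
  bint hS (I1_meas hlam hmu ht hf hg hf' hg') _ fun z => by
    rw [abs_of_nonneg (I1_nonneg hlam hmu ht (hf' z) (hg' z))]
    exact I1_le hlam hmu ht (hf' z) (hg' z)

lemma cell_jensen {lam mu t : ℝ} (hlam : 0 < lam) (hmu : 0 < mu) (ht : 0 < t)
    {S : Set (ℝ × ℝ)} (hS : volume S ≠ ⊤) {f g : ℝ × ℝ → ℝ} (hf : Measurable f) (hg : Measurable g)
    (hf' : ∀ z, f z ∈ Set.Icc (0:ℝ) 1) (hg' : ∀ z, g z ∈ Set.Icc (0:ℝ) 1) :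
    volume.real S * I1 lam mu t ((∫ z in S, f z) / volume.real S) ((∫ z in S, g z) / volume.real S)
      ≤ ∫ z in S, I1 lam mu t (f z) (g z) := by
  have hI : 0 ≤ ∫ z in S, I1 lam mu t (f z) (g z) :=
    integral_nonneg fun z => I1_nonneg hlam hmu ht (hf' z) (hg' z)
  rcases (measureReal_nonneg (μ := volume) (s := S)).eq_or_lt with h0 | h0
  · rw [← h0]; simpa using hI
  rw [mul_comm, ← le_div_iff₀ h0, I1_eq]
  refine ciSup_le fun v => ?_
  rw [le_div_iff₀ h0]
  set p := p11 lam mu t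
  set q := p01 lam mu t
  have if1 := bint01 hS hf hf'
  have ig1 := bint01 hS hg hg'
  have ic : IntegrableOn (fun _ : ℝ × ℝ => ell q v) S := bint hS measurable_const _ (fun _ => le_rfl)
  have e : ∀ z, gg p q (f z) (g z) v = (v * g z - (ell p v - ell q v) * f z) - ell q v := by
    intro z; unfold gg; ring
  have ii : IntegrableOn (fun z => gg p q (f z) (g z) v) S := by
    simp_rw [e]
    exact ((ig1.const_mul v).sub (if1.const_mul _)).sub ic
  have key : gg p q ((∫ z in S, f z) / volume.real S) ((∫ z in S, g z) / volume.real S) v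
      * volume.real S = ∫ z in S, gg p q (f z) (g z) v := by
    simp_rw [e]
    have ix : IntegrableOn (fun z => v * g z - (ell p v - ell q v) * f z) S :=
      (ig1.const_mul v).sub (if1.const_mul _)
    rw [integral_sub ix ic,
      integral_sub (ig1.const_mul v) (if1.const_mul _), integral_const_mul, integral_const_mul]
    simp only [integral_const, measureReal_restrict_apply_univ, smul_eq_mul]
    unfold gg
    field_simp
    ring
  rw [key]
  exact integral_mono ii (bintI hlam hmu ht hS hf hg hf' hg')
    fun z => gg_le_I1 hlam hmu ht (hf' z) (hg' z) v

lemma avg_dev {S : Set (ℝ × ℝ)} (hS : volume S ≠ ⊤) {f : ℝ × ℝ → ℝ} (hf : Measurable f)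
    (hf' : ∀ z, f z ∈ Set.Icc (0:ℝ) 1) (c : ℝ) :
    ∫ z in S, |f z - (∫ z in S, f z) / volume.real S| ≤ 2 * ∫ z in S, |f z - c| := by
  have if1 := bint01 hS hf hf'
  have ic : ∀ c : ℝ, IntegrableOn (fun _ : ℝ × ℝ => c) S :=
    fun c => bint hS measurable_const |c| (fun _ => le_rfl)
  have ia : ∀ c : ℝ, IntegrableOn (fun z => |f z - c|) S := fun c => (if1.sub (ic c)).abs
  rcases (measureReal_nonneg (μ := volume) (s := S)).eq_or_lt with h0 | h0
  · have : volume S = 0 := by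
      rw [← measureReal_eq_zero_iff hS]; exact h0.symm
    rw [Measure.restrict_eq_zero.2 this]; simp
  set a := (∫ z in S, f z) / volume.real S
  have h1 : ∫ z in S, |f z - a| ≤ ∫ z in S, (|f z - c| + |c - a|) :=
    integral_mono (ia a) ((ia c).add (ic _)) fun z => abs_sub_le _ _ _
  rw [integral_add (ia c) (ic _)] at h1
  simp only [integral_const, measureReal_restrict_apply_univ, smul_eq_mul] at h1
  have h2 : volume.real S * |c - a| ≤ ∫ z in S, |f z - c| := by
    have : volume.real S * |c - a| = |∫ z in S, (f z - c)| := by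
      rw [integral_sub if1 (ic c)]
      simp only [integral_const, measureReal_restrict_apply_univ, smul_eq_mul]
      rw [abs_sub_comm, ← abs_of_pos h0, ← abs_mul, abs_of_pos h0]
      congr 1
      simp only [a]
      field_simp
    rw [this]
    exact abs_integral_le_integral_abs
  linarith

lemma cell_lower {lam mu t : ℝ} (hlam : 0 < lam) (hmu : 0 < mu) (ht : 0 < t) {ε L : ℝ}
    (hL0 : 0 ≤ L)
    (hL : ∀ u ∈ Set.Icc (0:ℝ) 1, ∀ x ∈ Set.Icc (0:ℝ) 1, ∀ u' ∈ Set.Icc (0:ℝ) 1,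
      ∀ x' ∈ Set.Icc (0:ℝ) 1,
      I1 lam mu t u x ≤ I1 lam mu t u' x' + ε + L * (|u - u'| + |x - x'|))
    {S : Set (ℝ × ℝ)} (hS : volume S ≠ ⊤) {f g : ℝ × ℝ → ℝ} (hf : Measurable f) (hg : Measurable g)
    (hf' : ∀ z, f z ∈ Set.Icc (0:ℝ) 1) (hg' : ∀ z, g z ∈ Set.Icc (0:ℝ) 1) (c d : ℝ) :
    ∫ z in S, I1 lam mu t (f z) (g z) ≤
    volume.real S * I1 lam mu t ((∫ z in S, f z) / volume.real S) ((∫ z in S, g z) / volume.real S)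
      + volume.real S * ε + 2 * L * ((∫ z in S, |f z - c|) + ∫ z in S, |g z - d|) := by
  have if1 := bint01 hS hf hf'
  have ig1 := bint01 hS hg hg'
  have ic : ∀ c : ℝ, IntegrableOn (fun _ : ℝ × ℝ => c) S :=
    fun c => bint hS measurable_const |c| (fun _ => le_rfl)
  have hfa := avg_dev hS hf hf' c
  have hga := avg_dev hS hg hg' d
  have ma := avg_mem hS hf hf'
  have mb := avg_mem hS hg hg'
  set a := (∫ z in S, f z) / volume.real S
  set b := (∫ z in S, g z) / volume.real S
  have ia : IntegrableOn (fun z => |f z - a|) S := (if1.sub (ic a)).abs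
  have ib : IntegrableOn (fun z => |g z - b|) S := (ig1.sub (ic b)).abs
  have h1 : ∫ z in S, I1 lam mu t (f z) (g z) ≤
      ∫ z in S, ((I1 lam mu t a b + ε) + L * (|f z - a| + |g z - b|)) :=
    integral_mono (bintI hlam hmu ht hS hf hg hf' hg')
      ((ic _).add ((ia.add ib).const_mul L)) fun z => hL _ (hf' z) _ (hg' z) _ ma _ mb
  have iab : IntegrableOn (fun z => L * (|f z - a| + |g z - b|)) S := (ia.add ib).const_mul L
  rw [integral_add (ic _) iab, integral_const_mul] at h1
  have h2 : ∫ z in S, (|f z - a| + |g z - b|) = (∫ z in S, |f z - a|) + ∫ z in S, |g z - b| :=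
    integral_add ia ib
  simp only [integral_const, measureReal_restrict_apply_univ, smul_eq_mul] at h1
  rw [h2] at h1
  nlinarith [mul_le_mul_of_nonneg_left (add_le_add hfa hga) hL0]

lemma part_vol {k : ℕ} {A : Fin k → Set ℝ} (hA : IsPartition k A) (i j : Fin k) :
    volume (A i ×ˢ A j) ≠ ⊤ := by
  have h : ∀ i, volume (A i) ≠ ⊤ := fun i =>
    ne_top_of_le_ne_top (b := volume (Set.Icc (0:ℝ) 1)) (by simp)
      (measure_mono (hA.2.2 ▸ Set.subset_iUnion A i))
  rw [Measure.volume_eq_prod, Measure.prod_prod]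
  exact ENNReal.mul_ne_top (h i) (h j)

lemma vol_real (A B : Set ℝ) :
    (volume A).toReal * (volume B).toReal = volume.real (A ×ˢ B) := by
  rw [Measure.real, Measure.volume_eq_prod, Measure.prod_prod, ENNReal.toReal_mul]

lemma unitSq_vol : volume unitSq = 1 := by
  unfold unitSq
  rw [Measure.volume_eq_prod, Measure.prod_prod]; simp

lemma part_sum {k : ℕ} {A : Fin k → Set ℝ} (hA : IsPartition k A) {F : ℝ × ℝ → ℝ}
    (hF : IntegrableOn F unitSq) :
    ∫ z in unitSq, F z = ∑ i, ∑ j, ∫ z in A i ×ˢ A j, F z := by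
  have hU : unitSq = ⋃ p : Fin k × Fin k, A p.1 ×ˢ A p.2 := by
    ext z
    simp only [unitSq, ← hA.2.2, Set.mem_prod, Set.mem_iUnion, Prod.exists]
    constructor
    · rintro ⟨⟨i, hi⟩, j, hj⟩; exact ⟨i, j, hi, hj⟩
    · rintro ⟨i, j, hi, hj⟩; exact ⟨⟨i, hi⟩, j, hj⟩
  have hF' := hF
  rw [hU] at hF' ⊢
  rw [integral_iUnion_fintype (s := fun p : Fin k × Fin k => A p.1 ×ˢ A p.2) (fun p => (hA.1 p.1).prod (hA.1 p.2)), Fintype.sum_prod_type]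
  · intro p q hpq
    rw [Function.onFun, Set.disjoint_prod]
    by_cases h : p.1 = q.1
    · exact Or.inr (hA.2.1 _ _ fun h2 => hpq (Prod.ext h h2))
    · exact Or.inl (hA.2.1 _ _ h)
  · exact fun p => hF'.mono_set (Set.subset_iUnion (fun p : Fin k × Fin k => A p.1 ×ˢ A p.2) p)

/-- The partition sum. -/
def PS (lam mu t : ℝ) (u h : ℝ → ℝ → ℝ) (k : ℕ) (A : Fin k → Set ℝ) : ℝ :=
  ∑ i : Fin k, ∑ j : Fin k, (volume (A i)).toReal * (volume (A j)).toReal *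
    I1 lam mu t (avgOn u (A i) (A j)) (avgOn h (A i) (A j))

/-- Measurable with values in the unit interval. -/
def Nice (f : ℝ → ℝ → ℝ) : Prop :=
  Measurable (Function.uncurry f) ∧ ∀ x y, f x y ∈ Set.Icc (0:ℝ) 1

lemma PS_le {lam mu t : ℝ} (hlam : 0 < lam) (hmu : 0 < mu) (ht : 0 < t) {u h : ℝ → ℝ → ℝ}
    (hu : Nice u) (hh : Nice h) {k : ℕ} {A : Fin k → Set ℝ} (hA : IsPartition k A) :
    PS lam mu t u h k A ≤ I1W lam mu t u h := by
  unfold PS I1W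
  rw [part_sum hA (bintI hlam hmu ht (by simp [unitSq_vol]) (f := fun p => u p.1 p.2)
    (g := fun p => h p.1 p.2) hu.1 hh.1 (fun z => hu.2 _ _) (fun z => hh.2 _ _))]
  refine Finset.sum_le_sum fun i _ => Finset.sum_le_sum fun j _ => ?_
  unfold avgOn
  rw [vol_real]
  exact cell_jensen hlam hmu ht (part_vol hA i j) (f := fun p => u p.1 p.2)
    (g := fun p => h p.1 p.2) hu.1 hh.1 (fun z => hu.2 _ _) (fun z => hh.2 _ _)

lemma part_of_map {k : ℕ} {ψ : ℝ → Fin k} (hψ : Measurable ψ) :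
    IsPartition k (fun i => Set.Icc (0:ℝ) 1 ∩ ψ ⁻¹' {i}) := by
  refine ⟨fun i => measurableSet_Icc.inter (hψ (measurableSet_singleton i)), ?_, ?_⟩
  · intro i j hij
    rw [Set.disjoint_left]
    rintro x ⟨_, h1⟩ ⟨_, h2⟩
    exact hij (h1.symm.trans h2)
  · ext x; simp

lemma PS_ge {lam mu t : ℝ} (hlam : 0 < lam) (hmu : 0 < mu) (ht : 0 < t) {ε L : ℝ}
    (hL0 : 0 ≤ L)
    (hL : ∀ u ∈ Set.Icc (0:ℝ) 1, ∀ x ∈ Set.Icc (0:ℝ) 1, ∀ u' ∈ Set.Icc (0:ℝ) 1,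
      ∀ x' ∈ Set.Icc (0:ℝ) 1,
      I1 lam mu t u x ≤ I1 lam mu t u' x' + ε + L * (|u - u'| + |x - x'|))
    {u h : ℝ → ℝ → ℝ}
    (hu : Nice u) (hh : Nice h) {k : ℕ} {ψ : ℝ → Fin k} (hψ : Measurable ψ)
    (c d : Fin k → Fin k → ℝ) :
    I1W lam mu t u h ≤ PS lam mu t u h k (fun i => Set.Icc (0:ℝ) 1 ∩ ψ ⁻¹' {i}) + ε
      + 2 * L * ((∫ z in unitSq, |u z.1 z.2 - c (ψ z.1) (ψ z.2)|) +
        ∫ z in unitSq, |h z.1 z.2 - d (ψ z.1) (ψ z.2)|) := by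
  have hA := part_of_map hψ
  set A : Fin k → Set ℝ := fun i => Set.Icc (0:ℝ) 1 ∩ ψ ⁻¹' {i} with hAdef
  have hq : ∀ (f : ℝ → ℝ → ℝ) (c : Fin k → Fin k → ℝ), Nice f →
      ∫ z in unitSq, |f z.1 z.2 - c (ψ z.1) (ψ z.2)| =
      ∑ i, ∑ j, ∫ z in A i ×ˢ A j, |f z.1 z.2 - c i j| := by
    intro f c hf
    rw [part_sum hA]
    · refine Finset.sum_congr rfl fun i _ => Finset.sum_congr rfl fun j _ => ?_
      refine setIntegral_congr_fun ((hA.1 i).prod (hA.1 j)) ?_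
      rintro z ⟨⟨_, h1⟩, ⟨_, h2⟩⟩
      simp only [Set.mem_preimage, Set.mem_singleton_iff] at h1 h2
      simp only [h1, h2]
    · have m1 : Measurable fun z : ℝ × ℝ => c (ψ z.1) (ψ z.2) :=
        (Measurable.of_discrete (f := Function.uncurry c)).comp
          ((hψ.comp measurable_fst).prodMk (hψ.comp measurable_snd))
      have m2 : Measurable fun z : ℝ × ℝ => f z.1 z.2 := hf.1
      refine bint (by simp [unitSq_vol]) (m2.sub m1).abs
        (1 + ∑ i, ∑ j, |c i j|) fun z => ?_
      rw [abs_abs]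
      refine (abs_sub _ _).trans (add_le_add ?_ ?_)
      · rw [abs_of_nonneg (hf.2 _ _).1]; exact (hf.2 _ _).2
      · calc _ ≤ ∑ j, |c (ψ z.1) j| := Finset.single_le_sum
              (f := fun j => |c (ψ z.1) j|) (fun _ _ => abs_nonneg _) (Finset.mem_univ _)
          _ ≤ _ := Finset.single_le_sum (f := fun i => ∑ j, |c i j|)
              (fun _ _ => Finset.sum_nonneg fun _ _ => abs_nonneg _) (Finset.mem_univ _)
  have h1 : ∑ i, ∑ j, volume.real (A i ×ˢ A j) = 1 := by
    have := part_sum hA (F := fun _ => (1:ℝ)) (bint (by simp [unitSq_vol]) measurable_const 1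
      (by simp))
    simp only [integral_const, measureReal_restrict_apply_univ, smul_eq_mul, mul_one] at this
    rw [← this, Measure.real, unitSq_vol]; simp
  rw [hq u c hu, hq h d hh]
  unfold I1W PS
  rw [part_sum hA (bintI hlam hmu ht (by simp [unitSq_vol]) (f := fun p => u p.1 p.2)
    (g := fun p => h p.1 p.2) hu.1 hh.1 (fun z => hu.2 _ _) (fun z => hh.2 _ _))]
  have h2 : ε = ∑ i, ∑ j, volume.real (A i ×ˢ A j) * ε := by
    simp_rw [← Finset.sum_mul]; rw [h1, one_mul]
  conv_rhs => rw [h2]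
  simp only [← Finset.sum_add_distrib, Finset.mul_sum]
  refine Finset.sum_le_sum fun i _ => Finset.sum_le_sum fun j _ => ?_
  unfold avgOn
  rw [vol_real]
  exact cell_lower hlam hmu ht hL0 hL (part_vol hA i j) (f := fun p => u p.1 p.2)
    (g := fun p => h p.1 p.2) hu.1 hh.1 (fun z => hu.2 _ _) (fun z => hh.2 _ _) _ _

lemma step_approx {f : ℝ → ℝ → ℝ} (hf : Nice f) {δ : ℝ} (hδ : 0 < δ) :
    ∃ (m : ℕ) (φ : ℝ → Fin m) (c : Fin m → Fin m → ℝ), Measurable φ ∧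
      ∫ z in unitSq, |f z.1 z.2 - c (φ z.1) (φ z.2)| ≤ δ := by
  have hUm : MeasurableSet unitSq := measurableSet_Icc.prod measurableSet_Icc
  have hUc : IsCompact unitSq := isCompact_Icc.prod isCompact_Icc
  have hUt : volume unitSq ≠ ⊤ := by simp [unitSq_vol]
  have hfi : IntegrableOn (fun z : ℝ × ℝ => f z.1 z.2) unitSq :=
    bint01 hUt hf.1 fun z => hf.2 _ _
  obtain ⟨g, -, hg1, hg2, hg3⟩ :=
    (hfi.integrable_indicator hUm).exists_hasCompactSupport_integral_sub_le (half_pos hδ)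
  have hg4 : ∫ z in unitSq, |f z.1 z.2 - g z| ≤ δ / 2 := by
    refine le_trans ?_ hg1
    have e : ∫ z in unitSq, |f z.1 z.2 - g z| =
        ∫ z in unitSq, ‖unitSq.indicator (fun z : ℝ × ℝ => f z.1 z.2) z - g z‖ :=
      setIntegral_congr_fun hUm fun z hz => by simp [Set.indicator_of_mem hz]
    rw [e]
    exact setIntegral_le_integral (((hfi.integrable_indicator hUm).sub hg3).norm)
      (Eventually.of_forall fun z => norm_nonneg _)
  have huc := hUc.uniformContinuousOn_of_continuous hg2.continuousOn
  rw [Metric.uniformContinuousOn_iff] at huc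
  obtain ⟨η, hη, huc⟩ := huc (δ / 2) (half_pos hδ)
  obtain ⟨n, hn⟩ := exists_nat_one_div_lt hη
  set N : ℝ := (n : ℝ) + 1 with hN
  have hNpos : 0 < N := by positivity
  let φ : ℝ → Fin (n + 2) := fun x => ⟨min ⌊x * N⌋₊ (n + 1), by omega⟩
  have hφm : Measurable φ := by
    have : Measurable fun x : ℝ => ⌊x * N⌋₊ := Nat.measurable_floor.comp (measurable_id.mul_const N)
    exact (Measurable.of_discrete (f := fun a : ℕ =>
      (⟨min a (n + 1), by omega⟩ : Fin (n + 2)))).comp this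
  let c : Fin (n + 2) → Fin (n + 2) → ℝ := fun i j => g ((i : ℝ) / N, (j : ℝ) / N)
  have hφ : ∀ x ∈ Set.Icc (0:ℝ) 1, ((φ x : ℕ) : ℝ) / N ∈ Set.Icc (0:ℝ) 1 ∧
      dist x (((φ x : ℕ) : ℝ) / N) ≤ 1 / N := by
    intro x hx
    have h0 : 0 ≤ x * N := mul_nonneg hx.1 hNpos.le
    have h1 : ⌊x * N⌋₊ ≤ n + 1 := by
      apply Nat.floor_le_of_le
      push_cast
      nlinarith [hx.2]
    have h2 : (φ x : ℕ) = ⌊x * N⌋₊ := min_eq_left h1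
    rw [h2]
    have h3 := Nat.floor_le h0
    have h4 := Nat.lt_floor_add_one (x * N)
    have h1' : ((⌊x * N⌋₊ : ℕ) : ℝ) ≤ N := by
      have h5 := (Nat.cast_le (α := ℝ)).2 h1
      push_cast at h5
      exact h5
    refine ⟨⟨by positivity, (div_le_one hNpos).2 h1'⟩, ?_⟩
    have : x - (⌊x * N⌋₊ : ℝ) / N = (x * N - ⌊x * N⌋₊) / N := by field_simp
    rw [Real.dist_eq, this, abs_of_nonneg (div_nonneg (by linarith) hNpos.le)]
    exact div_le_div_of_nonneg_right (by linarith) hNpos.le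
  refine ⟨n + 2, φ, c, hφm, ?_⟩
  have hgi : IntegrableOn g unitSq := hg3.integrableOn
  have hk : ∀ z ∈ unitSq, |f z.1 z.2 - c (φ z.1) (φ z.2)| ≤ |f z.1 z.2 - g z| + δ / 2 := by
    rintro z ⟨hz1, hz2⟩
    obtain ⟨a1, a2⟩ := hφ _ hz1
    obtain ⟨b1, b2⟩ := hφ _ hz2
    have := huc z ⟨hz1, hz2⟩ (((φ z.1 : ℕ) : ℝ) / N, ((φ z.2 : ℕ) : ℝ) / N) ⟨a1, b1⟩
      (by rw [Prod.dist_eq, max_lt_iff]; exact ⟨a2.trans_lt hn, b2.trans_lt hn⟩)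
    rw [Real.dist_eq] at this
    have h5 := abs_sub_le (f z.1 z.2) (g z) (c (φ z.1) (φ z.2))
    exact h5.trans (by gcongr)
  have icc : IntegrableOn (fun _ : ℝ × ℝ => δ / 2) unitSq :=
    bint hUt measurable_const _ fun _ => le_rfl
  have ifg : IntegrableOn (fun z : ℝ × ℝ => |f z.1 z.2 - g z|) unitSq := (hfi.sub hgi).abs
  have h6 : ∫ z in unitSq, |f z.1 z.2 - c (φ z.1) (φ z.2)| ≤
      ∫ z in unitSq, (|f z.1 z.2 - g z| + δ / 2) := by
    refine integral_mono_of_nonneg (Eventually.of_forall fun z => abs_nonneg _) (ifg.add icc) ?_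
    exact (ae_restrict_mem hUm).mono hk
  rw [integral_add ifg icc] at h6
  simp only [integral_const, measureReal_restrict_apply_univ, smul_eq_mul] at h6
  have : volume.real unitSq = 1 := by rw [Measure.real, unitSq_vol]; simp
  rw [this] at h6
  linarith

lemma mpb_pres {σ : ℝ → ℝ} (hσ : IsMPB σ) :
    MeasurePreserving σ (volume.restrict (Set.Icc (0:ℝ) 1)) (volume.restrict (Set.Icc (0:ℝ) 1)) := by
  refine ⟨hσ.1, ?_⟩
  ext s hs
  rw [Measure.map_apply hσ.1 hs, Measure.restrict_apply (hσ.1 hs), Measure.restrict_apply hs,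
    ← (hσ.2.2 _ (hs.inter measurableSet_Icc) Set.inter_subset_right).1]
  congr 1
  ext x
  simp only [Set.mem_inter_iff, Set.mem_preimage]
  constructor
  · rintro ⟨h1, h2⟩; exact ⟨⟨h1, hσ.2.1.mapsTo h2⟩, h2⟩
  · rintro ⟨⟨h1, _⟩, h2⟩; exact ⟨h1, h2⟩

lemma mpb_integral {σ : ℝ → ℝ} (hσ : IsMPB σ) {F : ℝ × ℝ → ℝ} (hF : Measurable F) :
    ∫ z in unitSq, F (σ z.1, σ z.2) = ∫ z in unitSq, F z := by
  have e : (volume : Measure (ℝ × ℝ)).restrict unitSq =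
      (volume.restrict (Set.Icc (0:ℝ) 1)).prod (volume.restrict (Set.Icc (0:ℝ) 1)) := by
    rw [Measure.prod_restrict]; rfl
  have hp := (mpb_pres hσ).prod (mpb_pres hσ)
  rw [← e] at hp
  conv_rhs => rw [← hp.map_eq]
  rw [integral_map hp.measurable.aemeasurable hF.aestronglyMeasurable]
  rfl

lemma mpb_id : IsMPB id := by
  refine ⟨measurable_id, Set.bijOn_id _, fun A hA hA' => ?_⟩
  simp [Set.inter_eq_left.2 hA']

lemma nice_perm {σ : ℝ → ℝ} (hσ : IsMPB σ) {h : ℝ → ℝ → ℝ} (hh : Nice h) : Nice (perm σ h) :=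
  ⟨hh.1.comp ((hσ.1.comp measurable_fst).prodMk (hσ.1.comp measurable_snd)),
    fun _ _ => hh.2 _ _⟩

lemma lower {lam mu t : ℝ} (hlam : 0 < lam) (hmu : 0 < mu) (ht : 0 < t) {u h : ℝ → ℝ → ℝ}
    (hu : Nice u) (hh : Nice h) {ε : ℝ} (hε : 0 < ε) :
    ∃ K : ℕ, ∀ k ≥ K, ∀ σ, IsMPB σ → ∃ A, IsPartition k A ∧
      I1W lam mu t u (perm σ h) ≤ PS lam mu t u (perm σ h) k A + ε := by
  obtain ⟨L, hL0, hL⟩ := I1_unif hlam hmu ht (half_pos hε)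
  have hδ : 0 < ε / (8 * (L + 1)) := by positivity
  obtain ⟨m, φ, c, hφ, hc⟩ := step_approx hu hδ
  obtain ⟨n, χ, d, hχ, hd⟩ := step_approx hh hδ
  refine ⟨m * n, fun k hk σ hσ => ?_⟩
  let e : Fin m × Fin n → Fin k := fun p => Fin.castLE hk (finProdFinEquiv p)
  have he : Function.Injective e := (Fin.castLE_injective hk).comp finProdFinEquiv.injective
  have : Nonempty (Fin m × Fin n) := ⟨(φ 0, χ 0)⟩
  let r : Fin k → Fin m × Fin n := Function.invFun e
  have hr : ∀ p, r (e p) = p := Function.leftInverse_invFun he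
  let ψ : ℝ → Fin k := fun x => e (φ x, χ (σ x))
  have hψ : Measurable ψ := (Measurable.of_discrete (f := e)).comp (hφ.prodMk (hχ.comp hσ.1))
  refine ⟨_, part_of_map hψ, ?_⟩
  have key := PS_ge hlam hmu ht hL0 hL hu (nice_perm hσ hh) hψ
    (fun i j => c (r i).1 (r j).1) (fun i j => d (r i).2 (r j).2)
  simp only [ψ, hr, perm] at key
  have m1 : Measurable fun z : ℝ × ℝ => |h z.1 z.2 - d (χ z.1) (χ z.2)| :=
    ((show Measurable fun z : ℝ × ℝ => h z.1 z.2 from hh.1).sub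
      ((Measurable.of_discrete (f := Function.uncurry d)).comp
          ((hχ.comp measurable_fst).prodMk (hχ.comp measurable_snd)))).abs
  have m2 := mpb_integral hσ m1
  simp only at m2
  rw [m2] at key
  have h3 : 2 * L * ((∫ z in unitSq, |u z.1 z.2 - c (φ z.1) (φ z.2)|) +
        ∫ z in unitSq, |h z.1 z.2 - d (χ z.1) (χ z.2)|) ≤ ε / 2 := by
    calc _ ≤ 2 * L * (ε / (8 * (L + 1)) + ε / (8 * (L + 1))) := by gcongr
      _ = ε / 2 * (L / (L + 1)) := by field_simp; ring
      _ ≤ ε / 2 * 1 := by gcongr; exact (div_le_one (by positivity)).2 (by linarith)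
      _ = _ := mul_one _
  exact key.trans (by simp only [ψ]; linarith)

/-- Convergence of the partition approximations of the rate functional. -/
theorem stmt_5 (lam mu t : ℝ) (hlam : 0 < lam) (hmu : 0 < mu) (ht : 0 < t)
    (u h : ℝ → ℝ → ℝ) (hu : IsGraphon u) (hh : IsGraphon h) :
    Filter.Tendsto
      (fun k : ℕ =>
        ⨅ σ : {σ : ℝ → ℝ // IsMPB σ},
          ⨆ P : {A : Fin k → Set ℝ // IsPartition k A},
            ∑ i : Fin k, ∑ j : Fin k,
              (volume (P.1 i)).toReal * (volume (P.1 j)).toReal *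
                I1 lam mu t (avgOn u (P.1 i) (P.1 j)) (avgOn (perm σ.1 h) (P.1 i) (P.1 j)))
      Filter.atTop
      (nhds (⨅ σ : {σ : ℝ → ℝ // IsMPB σ}, I1W lam mu t u (perm σ.1 h))) := by
  have hu' : Nice u := ⟨hu.1, hu.2.1⟩
  have hh' : Nice h := ⟨hh.1, hh.2.1⟩
  have : Nonempty {σ : ℝ → ℝ // IsMPB σ} := ⟨⟨id, mpb_id⟩⟩
  have hW0 : ∀ σ : {σ : ℝ → ℝ // IsMPB σ}, 0 ≤ I1W lam mu t u (perm σ.1 h) := fun σ =>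
    integral_nonneg fun z => I1_nonneg hlam hmu ht (hu.2.1 _ _) ((nice_perm σ.2 hh').2 _ _)
  have hup : ∀ (k : ℕ) (σ : {σ : ℝ → ℝ // IsMPB σ}) (P : {A : Fin k → Set ℝ // IsPartition k A}),
      PS lam mu t u (perm σ.1 h) k P.1 ≤ I1W lam mu t u (perm σ.1 h) :=
    fun k σ P => PS_le hlam hmu ht hu' (nice_perm σ.2 hh') P.2
  have hPS0 : ∀ (k : ℕ) (σ : {σ : ℝ → ℝ // IsMPB σ}) (P : {A : Fin k → Set ℝ // IsPartition k A}),
      0 ≤ PS lam mu t u (perm σ.1 h) k P.1 := by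
    intro k σ P
    refine Finset.sum_nonneg fun i _ => Finset.sum_nonneg fun j _ => mul_nonneg (by positivity) ?_
    unfold avgOn
    rw [vol_real]
    exact I1_nonneg hlam hmu ht
      (avg_mem (part_vol P.2 i j) (f := fun p => u p.1 p.2) hu'.1 fun z => hu'.2 _ _)
      (avg_mem (part_vol P.2 i j) (f := fun p => perm σ.1 h p.1 p.2) (nice_perm σ.2 hh').1
        fun z => (nice_perm σ.2 hh').2 _ _)
  change Tendsto (fun k : ℕ => ⨅ σ : {σ : ℝ → ℝ // IsMPB σ},
    ⨆ P : {A : Fin k → Set ℝ // IsPartition k A}, PS lam mu t u (perm σ.1 h) k P.1) atTop _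
  have hbdd : BddBelow (Set.range fun σ : {σ : ℝ → ℝ // IsMPB σ} =>
      I1W lam mu t u (perm σ.1 h)) := ⟨0, by rintro _ ⟨σ, rfl⟩; exact hW0 σ⟩
  rw [Metric.tendsto_atTop]
  intro ε hε
  obtain ⟨K, hK⟩ := lower hlam hmu ht hu' hh' (half_pos hε)
  refine ⟨K, fun k hk => ?_⟩
  have h1 : (⨅ σ : {σ : ℝ → ℝ // IsMPB σ}, ⨆ P : {A : Fin k → Set ℝ // IsPartition k A},
      PS lam mu t u (perm σ.1 h) k P.1) ≤
      ⨅ σ : {σ : ℝ → ℝ // IsMPB σ}, I1W lam mu t u (perm σ.1 h) := by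
    refine ciInf_mono ⟨0, ?_⟩ fun σ => Real.iSup_le (hup k σ) (hW0 σ)
    rintro _ ⟨σ, rfl⟩
    exact Real.iSup_nonneg (hPS0 k σ)
  have h2 : (⨅ σ : {σ : ℝ → ℝ // IsMPB σ}, I1W lam mu t u (perm σ.1 h)) - ε / 2 ≤
      ⨅ σ : {σ : ℝ → ℝ // IsMPB σ}, ⨆ P : {A : Fin k → Set ℝ // IsPartition k A},
      PS lam mu t u (perm σ.1 h) k P.1 := by
    refine le_ciInf fun σ => ?_
    obtain ⟨A, hA, hAle⟩ := hK k hk σ.1 σ.2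
    have h3 := ciInf_le hbdd σ
    have h4 : PS lam mu t u (perm σ.1 h) k A ≤
        ⨆ P : {A : Fin k → Set ℝ // IsPartition k A}, PS lam mu t u (perm σ.1 h) k P.1 :=
      le_ciSup (f := fun P : {A : Fin k → Set ℝ // IsPartition k A} =>
        PS lam mu t u (perm σ.1 h) k P.1)
        ⟨I1W lam mu t u (perm σ.1 h), by rintro _ ⟨P, rfl⟩; exact hup k σ P⟩ ⟨A, hA⟩
    linarith
  rw [Real.dist_eq, abs_lt]
  constructor <;> linarith
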